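/- arXiv:2409.09656 — 3 statements merged into one kernel-verified Lean document; each statement's English description precedes it below -/
import Mathlib

section
/- Let 𝔤 be a finite-dimensional complex Lie algebra, B a nondegenerate symmetric invariant bilinear form on 𝔤 (B([a,b],c) = B(a,[b,c]) for all a,b,c), and x ∈ 𝔤 an element such that ad x is diagonalizable, i.e. 𝔤 is the direct sum of the eigenspaces 𝔤_j = {a ∈ 𝔤 : [x,a] = j·a}. Let f ∈ 𝔤_{−1} and assume that the linear map 𝔤_{1/2} → 𝔤_{−1/2}, a ↦ [f,a], is injective. Then the bilinear form ⟨a,b⟩ := B(f, [a,b]) on 𝔤_{1/2} is skew-symmetric (alternating) and nondegenerate. -/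
/-- Eigenspaces of `ad x` for eigenvalues `μ`, `ν` with `μ + ν ≠ 0` are orthogonal with respect to
an invariant bilinear form. -/
theorem invariant_form_eq_zero_of_mem_eigenspace_ad
    {K L : Type*} [Field K] [LieRing L] [LieAlgebra K L] {B : L →ₗ[K] L →ₗ[K] K}
    (hinv : ∀ a b c : L, B ⁅a, b⁆ c = B a ⁅b, c⁆) {x a b : L} {μ ν : K} (hμν : μ + ν ≠ 0)
    (ha : a ∈ (LieAlgebra.ad K L x).eigenspace μ) (hb : b ∈ (LieAlgebra.ad K L x).eigenspace ν) :
    B a b = 0 := by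
  rw [Module.End.mem_eigenspace_iff, LieAlgebra.ad_apply] at ha hb
  have h := hinv a x b
  rw [← lie_skew, ha, hb, map_neg, map_smul, LinearMap.neg_apply, LinearMap.smul_apply, map_smul,
    smul_eq_mul, smul_eq_mul] at h
  refine (mul_eq_zero.mp ?_).resolve_left hμν
  linear_combination -h

/-- The bracket of eigenvectors of `ad x` is in the eigenspace of the sum of the eigenvalues. -/
theorem lie_mem_eigenspace_ad_add
    {K L : Type*} [Field K] [LieRing L] [LieAlgebra K L] {x a b : L} {μ ν : K}
    (ha : a ∈ (LieAlgebra.ad K L x).eigenspace μ) (hb : b ∈ (LieAlgebra.ad K L x).eigenspace ν) :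
    ⁅a, b⁆ ∈ (LieAlgebra.ad K L x).eigenspace (μ + ν) := by
  rw [Module.End.mem_eigenspace_iff, LieAlgebra.ad_apply] at *
  rw [leibniz_lie, ha, hb, smul_lie, lie_smul, add_smul]

/-- Let `𝔤` be a finite-dimensional complex Lie algebra, `B` a nondegenerate symmetric
invariant bilinear form, and `x ∈ 𝔤` with `ad x` diagonalizable (i.e. `𝔤` is the sum of
its eigenspaces).  Let `f` be in the `(-1)`-eigenspace and assume
`ad f : 𝔤_{1/2} → 𝔤_{-1/2}` is injective.  Then `⟨a, b⟩ := B(f, [a,b])` is an alternating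
(skew-symmetric) nondegenerate bilinear form on the `1/2`-eigenspace `𝔤_{1/2}`. -/
theorem good_pair_symplectic_form
    (𝔤 : Type*) [LieRing 𝔤] [LieAlgebra ℂ 𝔤] [FiniteDimensional ℂ 𝔤]
    (B : 𝔤 →ₗ[ℂ] 𝔤 →ₗ[ℂ] ℂ)
    (hsymm : ∀ a b : 𝔤, B a b = B b a)
    (hinv : ∀ a b c : 𝔤, B ⁅a, b⁆ c = B a ⁅b, c⁆)
    (hnd : ∀ a : 𝔤, (∀ b : 𝔤, B a b = 0) → a = 0)
    (x : 𝔤)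
    (hdiag : (⨆ μ : ℂ, (LieAlgebra.ad ℂ 𝔤 x).eigenspace μ) = ⊤)
    (f : 𝔤) (hf : f ∈ (LieAlgebra.ad ℂ 𝔤 x).eigenspace (-1))
    (hinj : ∀ a ∈ (LieAlgebra.ad ℂ 𝔤 x).eigenspace (1/2 : ℂ), ⁅f, a⁆ = 0 → a = 0) :
    (∀ a ∈ (LieAlgebra.ad ℂ 𝔤 x).eigenspace (1/2 : ℂ), B f ⁅a, a⁆ = 0) ∧
    (∀ a ∈ (LieAlgebra.ad ℂ 𝔤 x).eigenspace (1/2 : ℂ),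
      ∀ b ∈ (LieAlgebra.ad ℂ 𝔤 x).eigenspace (1/2 : ℂ),
        B f ⁅a, b⁆ = - B f ⁅b, a⁆) ∧
    (∀ a ∈ (LieAlgebra.ad ℂ 𝔤 x).eigenspace (1/2 : ℂ),
      (∀ b ∈ (LieAlgebra.ad ℂ 𝔤 x).eigenspace (1/2 : ℂ), B f ⁅a, b⁆ = 0) → a = 0) := by
  refine ⟨fun a _ => by rw [lie_self, map_zero],
    fun a _ b _ => by rw [← lie_skew, map_neg], fun a ha hab => ?_⟩
  refine hinj a ha (hnd _ fun b => ?_)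
  have hb : b ∈ ⨆ μ : ℂ, (LieAlgebra.ad ℂ 𝔤 x).eigenspace μ := hdiag ▸ Submodule.mem_top
  induction hb using Submodule.iSup_induction' with
  | mem μ b hb =>
    by_cases hμ : μ = 1 / 2
    · subst hμ
      rw [hinv, hab b hb]
    · refine invariant_form_eq_zero_of_mem_eigenspace_ad hinv (fun h => hμ ?_)
        (lie_mem_eigenspace_ad_add hf ha) hb
      linear_combination h
  | zero => exact map_zero _
  | add b c _ _ hb hc => rw [map_add, hb, hc, add_zero]
end

section
/- Let K be a field and let (C^n, d^n)_{n∈ℤ} be a filtered cochain complex over K whose filtration is graded-acyclic in nonzero degrees. Then for every p ∈ ℤ and every n ≠ 0, F^pC^n ∩ ker d^n = d^{n−1}(F^pC^{n−1}); in particular ker d^n = im d^{n−1} for all n ≠ 0, i.e. the cohomology of the complex vanishes in all nonzero degrees. -/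
/-- Filtered-acyclicity principle: if a filtered cochain complex over a field `K`
(with filtration decreasing, compatible with the differential, exhaustive, and for each
degree eventually zero) is graded-acyclic in nonzero degrees, then for every `p` and
every nonzero degree `n = m + 1` one has `F^pC^n ∩ ker dⁿ = dⁿ⁻¹(F^pC^{n-1})`; in
particular `ker dⁿ = im dⁿ⁻¹` for all `n ≠ 0`, i.e. the cohomology vanishes in all
nonzero degrees. -/
theorem filtered_acyclicity
    (K : Type*) [Field K]
    (C : ℤ → Type*) [∀ n, AddCommGroup (C n)] [∀ n, Module K (C n)]
    (d : ∀ n : ℤ, C n →ₗ[K] C (n + 1))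
    (hdd : ∀ (n : ℤ) (a : C n), d (n + 1) (d n a) = 0)
    (F : ∀ n : ℤ, ℤ → Submodule K (C n))
    (hmono : ∀ (n p : ℤ), F n (p + 1) ≤ F n p)
    (hcompat : ∀ (n p : ℤ), (F n p).map (d n) ≤ F (n + 1) p)
    (hexh : ∀ (n : ℤ) (a : C n), ∃ p : ℤ, a ∈ F n p)
    (hbdd : ∀ n : ℤ, ∃ p₀ : ℤ, ∀ p ≥ p₀, F n p = ⊥)
    (hacyc : ∀ p m : ℤ, m + 1 ≠ 0 →
      F (m + 1) p ⊓ (F (m + 1 + 1) (p + 1)).comap (d (m + 1)) ≤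
        (F m p).map (d m) ⊔ F (m + 1) (p + 1)) :
    (∀ p m : ℤ, m + 1 ≠ 0 →
      F (m + 1) p ⊓ LinearMap.ker (d (m + 1)) = (F m p).map (d m)) ∧
    (∀ m : ℤ, m + 1 ≠ 0 →
      LinearMap.ker (d (m + 1)) = LinearMap.range (d m)) := by
  have le_map : ∀ p m : ℤ, m + 1 ≠ 0 →
      F (m + 1) p ⊓ LinearMap.ker (d (m + 1)) ≤ (F m p).map (d m) := by
    intro p m hm
    obtain ⟨p₀, hp₀⟩ := hbdd (m + 1)
    suffices h : ∀ (k : ℕ) (p : ℤ), p₀ ≤ p + k →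
        F (m + 1) p ⊓ LinearMap.ker (d (m + 1)) ≤ (F m p).map (d m) from
      h (p₀ - p).toNat p (by omega)
    intro k
    induction k with
    | zero =>
      intro p hp
      rw [hp₀ p (by simpa using hp), bot_inf_eq]
      exact bot_le
    | succ k ih =>
      rintro p hp x ⟨hxF, hxd⟩
      have hxd : d (m + 1) x = 0 := hxd
      have hx : d (m + 1) x ∈ F (m + 1 + 1) (p + 1) := hxd ▸ zero_mem _
      obtain ⟨y, hy, z, hz, rfl⟩ := Submodule.mem_sup.mp (hacyc p m hm ⟨hxF, hx⟩)
      have hzd : d (m + 1) z = 0 := by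
        obtain ⟨w, -, rfl⟩ := hy
        simpa [hdd] using hxd
      have hz' := ih (p + 1) (by push_cast at hp; omega) ⟨hz, hzd⟩
      exact add_mem hy (Submodule.map_mono (hmono m p) hz')
  refine ⟨fun p m hm => le_antisymm (le_map p m hm) (le_inf (hcompat m p) ?_),
    fun m hm => le_antisymm (fun x hx => ?_) ?_⟩
  · rintro _ ⟨a, -, rfl⟩
    exact hdd m a
  · obtain ⟨p, hp⟩ := hexh (m + 1) x
    exact LinearMap.map_le_range (le_map p m hm ⟨hp, hx⟩)
  · rintro _ ⟨a, rfl⟩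
    exact hdd m a
end

section
/- Let K be a field and let (C^n, d^n)_{n∈ℤ} be a filtered cochain complex over K whose filtration is graded-acyclic in nonzero degrees. Then for every p ∈ ℤ, F^pC^0 ∩ (d^0)^{−1}(F^{p+1}C^1) = F^{p+1}C^0 + (F^pC^0 ∩ ker d^0). In particular, for every a ∈ F^pC^0 with d^0(a) ∈ F^{p+1}C^1 there exists E ∈ F^pC^0 with d^0(E) = 0 and E − a ∈ F^{p+1}C^0. -/
/-- In a filtered complex `A → B → D` whose filtration on `B` is eventually zero and whose
associated graded is exact at `B`, every cocycle of filtration degree `q` is the boundary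
of an element of filtration degree `q`. -/
theorem exists_boundary_of_graded_exact
    {K A B D : Type*} [Ring K] [AddCommGroup A] [AddCommGroup B] [AddCommGroup D]
    [Module K A] [Module K B] [Module K D] (f : A →ₗ[K] B) (g : B →ₗ[K] D)
    (hgf : ∀ a, g (f a) = 0)
    (FA : ℤ → Submodule K A) (FB : ℤ → Submodule K B) (FD : ℤ → Submodule K D)
    (hmono : ∀ p, FA (p + 1) ≤ FA p)
    (hbdd : ∃ p₀ : ℤ, ∀ p ≥ p₀, FB p = ⊥)
    (hexact : ∀ p, FB p ⊓ (FD (p + 1)).comap g ≤ (FA p).map f ⊔ FB (p + 1))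
    (q : ℤ) (z : B) (hz : z ∈ FB q) (hgz : g z = 0) :
    ∃ b ∈ FA q, f b = z := by
  obtain ⟨p₀, hp₀⟩ := hbdd
  obtain ⟨k, hk⟩ : ∃ k : ℕ, p₀ ≤ q + k := ⟨(p₀ - q).toNat, by omega⟩
  induction k generalizing q z with
  | zero =>
    rw [hp₀ q (by simpa using hk), Submodule.mem_bot] at hz
    exact ⟨0, zero_mem _, by rw [map_zero, hz]⟩
  | succ k ih =>
    have hmem : z ∈ FB q ⊓ (FD (q + 1)).comap g :=
      ⟨hz, by simp [hgz]⟩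
    obtain ⟨_, ⟨b, hb, rfl⟩, z', hz', rfl⟩ := Submodule.mem_sup.mp (hexact q hmem)
    rw [map_add, hgf, zero_add] at hgz
    obtain ⟨b', hb', rfl⟩ := ih (q + 1) z' hz' hgz (by push_cast at hk; omega)
    exact ⟨b + b', add_mem hb (hmono q hb'), map_add f b b'⟩


/-- Degree-zero correction principle: if a filtered cochain complex over a field `K`
(with filtration decreasing, compatible with the differential, exhaustive, and for each
degree eventually zero) is graded-acyclic in nonzero degrees, then for every `p`,
`F^pC^0 ∩ (d^0)⁻¹(F^{p+1}C^1) = F^{p+1}C^0 + (F^pC^0 ∩ ker d^0)`.  In particular,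
every `a ∈ F^pC^0` with `d^0 a ∈ F^{p+1}C^1` differs from a cocycle `E ∈ F^pC^0` by an
element of `F^{p+1}C^0`. -/
theorem filtered_degree_zero_correction
    (K : Type*) [Field K]
    (C : ℤ → Type*) [∀ n, AddCommGroup (C n)] [∀ n, Module K (C n)]
    (d : ∀ n : ℤ, C n →ₗ[K] C (n + 1))
    (hdd : ∀ (n : ℤ) (a : C n), d (n + 1) (d n a) = 0)
    (F : ∀ n : ℤ, ℤ → Submodule K (C n))
    (hmono : ∀ (n p : ℤ), F n (p + 1) ≤ F n p)
    (hcompat : ∀ (n p : ℤ), (F n p).map (d n) ≤ F (n + 1) p)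
    (hexh : ∀ (n : ℤ) (a : C n), ∃ p : ℤ, a ∈ F n p)
    (hbdd : ∀ n : ℤ, ∃ p₀ : ℤ, ∀ p ≥ p₀, F n p = ⊥)
    (hacyc : ∀ p m : ℤ, m + 1 ≠ 0 →
      F (m + 1) p ⊓ (F (m + 1 + 1) (p + 1)).comap (d (m + 1)) ≤
        (F m p).map (d m) ⊔ F (m + 1) (p + 1)) :
    (∀ p : ℤ,
      F 0 p ⊓ (F (0 + 1) (p + 1)).comap (d 0) =
        F 0 (p + 1) ⊔ (F 0 p ⊓ LinearMap.ker (d 0))) ∧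
    (∀ p : ℤ, ∀ a ∈ F 0 p, d 0 a ∈ F (0 + 1) (p + 1) →
      ∃ E ∈ F 0 p, d 0 E = 0 ∧ E - a ∈ F 0 (p + 1)) := by
  have correction : ∀ p : ℤ, ∀ a ∈ F 0 p, d 0 a ∈ F (0 + 1) (p + 1) →
      ∃ E ∈ F 0 p, d 0 E = 0 ∧ E - a ∈ F 0 (p + 1) := by
    intro p a ha hda
    obtain ⟨b, hb, hdb⟩ := exists_boundary_of_graded_exact (d 0) (d (0 + 1)) (hdd 0) (F 0)
      (F (0 + 1)) (F (0 + 1 + 1)) (hmono 0) (hbdd (0 + 1))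
      (fun p => hacyc p 0 (by norm_num)) (p + 1) (d 0 a) hda (hdd 0 a)
    refine ⟨a - b, sub_mem ha (hmono 0 p hb), by rw [map_sub, hdb, sub_self], ?_⟩
    rw [sub_sub_cancel_left]
    exact neg_mem hb
  refine ⟨fun p => le_antisymm ?_ (sup_le ?_ ?_), correction⟩
  · rintro a ⟨ha, hda⟩
    obtain ⟨E, hE, hdE, hEa⟩ := correction p a ha hda
    exact Submodule.mem_sup.mpr
      ⟨a - E, by rw [← neg_sub]; exact neg_mem hEa, E, ⟨hE, hdE⟩, sub_add_cancel a E⟩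
  · exact le_inf (hmono 0 p) (Submodule.map_le_iff_le_comap.mp (hcompat 0 (p + 1)))
  · rintro a ⟨ha, hda⟩
    exact ⟨ha, by simp [LinearMap.mem_ker.mp hda]⟩
end
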